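/- arXiv:2004.08905 — 2 statements merged into one kernel-verified Lean document; each statement's English description precedes it below -/
import Mathlib

section
/- (Nonempty first-Melnikov resonant sets force |j|^{3/2} ≲ ⟨ℓ⟩.) There exist ε₀ ∈ (0,1) and C > 0, depending only on 𝚑, g, γ, κ₁, κ₂, the tangential sites, C₀ and τ, such that if ε ≤ υ ≤ ε₀, then for every ℓ ∈ ℤ^ν and j ∈ S₀ᶜ with j⃗·ℓ + j = 0 the following holds: if there exists κ ∈ [κ₁, κ₂] with |ω⃗_ε(κ)·ℓ + μ_j(κ)| < 4υ·|j|^{3/2}·⟨ℓ⟩^{−τ}, then |j|^{3/2} ≤ C·⟨ℓ⟩. -/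
open Real Finset Set

/-- `G_j := j · tanh(dpt · j)` (finite depth `dpt`). -/
noncomputable def Gfun (dpt : ℝ) (j : ℤ) : ℝ := (j : ℝ) * Real.tanh (dpt * (j : ℝ))

/-- The linear frequencies `ω_j(κ)`. -/
noncomputable def omegaF (dpt g γ : ℝ) (j : ℤ) (κ : ℝ) : ℝ :=
  Real.sqrt (κ * Gfun dpt j * (j : ℝ) ^ 2 + g * Gfun dpt j + (γ * Gfun dpt j / (2 * (j : ℝ))) ^ 2)

/-- The linear frequencies `Ω_j(κ) = ω_j(κ) + (γ/2) G_j / j`. -/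
noncomputable def OmegaF (dpt g γ : ℝ) (j : ℤ) (κ : ℝ) : ℝ :=
  omegaF dpt g γ j κ + γ / 2 * Gfun dpt j / (j : ℝ)

/-- The perturbed frequencies μ_j(κ). -/
noncomputable def muF (dpt g γ : ℝ) (m32 m1 m12 : ℝ → ℝ) (r : ℤ → ℝ → ℝ) (j : ℤ) (κ : ℝ) : ℝ :=
  m32 κ * OmegaF dpt g γ j κ + m1 κ * (j : ℝ) + m12 κ * |(j : ℝ)| ^ ((1 : ℝ) / 2) + r j κ

lemma tanh_le_tanh {x y : ℝ} (h : x ≤ y) : Real.tanh x ≤ Real.tanh y := by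
  have h_mem (z : ℝ) : Real.tanh z ∈ Set.Ioo (-1 : ℝ) 1 :=
    ⟨Real.neg_one_lt_tanh z, Real.tanh_lt_one z⟩
  rwa [← Real.artanh_le_artanh_iff (h_mem x) (h_mem y), Real.artanh_tanh, Real.artanh_tanh]

lemma tanh_pos_of_pos {x : ℝ} (h : 0 < x) : 0 < Real.tanh x := by
  rw [Real.tanh_eq_sinh_div_cosh]
  exact div_pos (Real.sinh_pos_iff.mpr h) (Real.cosh_pos x)

lemma one_le_abs_intCast {j : ℤ} (hj : j ≠ 0) : 1 ≤ |(j : ℝ)| := by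
  exact_mod_cast Int.one_le_abs hj

lemma Gfun_eq_abs (dpt : ℝ) (j : ℤ) :
    Gfun dpt j = |(j : ℝ)| * Real.tanh (dpt * |(j : ℝ)|) := by
  unfold Gfun
  rcases abs_choice (j : ℝ) with h | h <;> rw [h]
  rw [mul_neg, Real.tanh_neg, neg_mul_neg]

lemma Gfun_lower_bound {dpt : ℝ} (hdpt : 0 < dpt) {j : ℤ} (hj : j ≠ 0) :
    |(j : ℝ)| * Real.tanh dpt ≤ Gfun dpt j := by
  rw [Gfun_eq_abs]
  gcongr
  exact tanh_le_tanh (le_mul_of_one_le_right hdpt.le (one_le_abs_intCast hj))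

lemma Gfun_nonneg {dpt : ℝ} (hdpt : 0 < dpt) {j : ℤ} (hj : j ≠ 0) : 0 ≤ Gfun dpt j :=
  (mul_nonneg (abs_nonneg _) (tanh_pos_of_pos hdpt).le).trans (Gfun_lower_bound hdpt hj)

lemma abs_vorticity_term_le (dpt γ : ℝ) {j : ℤ} (hj : j ≠ 0) :
    |γ / 2 * Gfun dpt j / (j : ℝ)| ≤ |γ| / 2 := by
  have hj' : (j : ℝ) ≠ 0 := Int.cast_ne_zero.mpr hj
  have h : γ / 2 * Gfun dpt j / (j : ℝ) = γ / 2 * Real.tanh (dpt * j) := by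
    unfold Gfun
    field_simp
  rw [h, abs_mul, abs_div, abs_two]
  exact mul_le_of_le_one_right (by positivity) (Real.abs_tanh_lt_one _).le

lemma omegaF_mono {dpt g γ κ κ' : ℝ} (hdpt : 0 < dpt) {j : ℤ} (hj : j ≠ 0) (h : κ ≤ κ') :
    omegaF dpt g γ j κ ≤ omegaF dpt g γ j κ' := by
  have hG := Gfun_nonneg hdpt hj
  unfold omegaF
  gcongr

lemma omegaF_lower_bound {dpt g γ κ : ℝ} (hdpt : 0 < dpt) (hg : 0 < g) (hκ : 0 < κ) {j : ℤ}
    (hj : j ≠ 0) :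
    √(κ * Real.tanh dpt) * |(j : ℝ)| ^ ((3 : ℝ) / 2) ≤ omegaF dpt g γ j κ := by
  have ht := tanh_pos_of_pos hdpt
  have hG := Gfun_nonneg hdpt hj
  have h_pow : (|(j : ℝ)| ^ ((3 : ℝ) / 2)) ^ 2 = |(j : ℝ)| ^ 3 := by
    rw [← Real.rpow_natCast, ← Real.rpow_mul (abs_nonneg _), ← Real.rpow_natCast]
    norm_num
  refine Real.le_sqrt_of_sq_le ?_
  rw [mul_pow, Real.sq_sqrt (by positivity), h_pow]
  calc κ * Real.tanh dpt * |(j : ℝ)| ^ 3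
      = κ * (|(j : ℝ)| * Real.tanh dpt) * |(j : ℝ)| ^ 2 := by ring
    _ ≤ κ * Gfun dpt j * |(j : ℝ)| ^ 2 := by
        gcongr
        exact Gfun_lower_bound hdpt hj
    _ = κ * Gfun dpt j * (j : ℝ) ^ 2 := by rw [sq_abs]
    _ ≤ _ := by
        have : 0 ≤ g * Gfun dpt j := by positivity
        have := sq_nonneg (γ * Gfun dpt j / (2 * (j : ℝ)))
        linarith

lemma abs_OmegaF_le {dpt g γ κ κ' : ℝ} (hdpt : 0 < dpt) {j : ℤ} (hj : j ≠ 0) (h : κ ≤ κ') :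
    |OmegaF dpt g γ j κ| ≤ omegaF dpt g γ j κ' + |γ| / 2 := by
  refine (abs_add_le _ _).trans (add_le_add ?_ (abs_vorticity_term_le dpt γ hj))
  have hω : 0 ≤ omegaF dpt g γ j κ := Real.sqrt_nonneg _
  rw [abs_of_nonneg hω]
  exact omegaF_mono hdpt hj h

lemma muF_lower_bound {dpt g γ κ₁ κ δ R : ℝ} (hdpt : 0 < dpt) (hg : 0 < g) (hκ₁ : 0 < κ₁)
    (hκ : κ₁ ≤ κ) (hδ : δ ≤ 1 / 2) {m32 m1 m12 : ℝ → ℝ} {r : ℤ → ℝ → ℝ} {j : ℤ} (hj : j ≠ 0)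
    (hm32 : |m32 κ - 1| ≤ δ) (hm1 : |m1 κ| ≤ δ) (hm12 : |m12 κ| ≤ δ) (hr : |r j κ| ≤ R) :
    (√(κ₁ * Real.tanh dpt) / 2 - 2 * δ) * |(j : ℝ)| ^ ((3 : ℝ) / 2) - |γ| - R
      ≤ muF dpt g γ m32 m1 m12 r j κ := by
  have h_one := one_le_abs_intCast hj
  have hδ0 : 0 ≤ δ := (abs_nonneg _).trans hm1
  set J := |(j : ℝ)| ^ ((3 : ℝ) / 2)
  have hω : √(κ₁ * Real.tanh dpt) * J ≤ omegaF dpt g γ j κ :=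
    (omegaF_lower_bound hdpt hg hκ₁ hj).trans (omegaF_mono hdpt hj hκ)
  have hω0 : 0 ≤ omegaF dpt g γ j κ := Real.sqrt_nonneg _
  have hm := abs_le.mp hm32
  have h_main : √(κ₁ * Real.tanh dpt) / 2 * J ≤ m32 κ * omegaF dpt g γ j κ := by
    nlinarith
  have h_vort : |m32 κ * (γ / 2 * Gfun dpt j / (j : ℝ))| ≤ |γ| := by
    rw [abs_mul, abs_of_nonneg (by linarith : 0 ≤ m32 κ)]
    calc m32 κ * |γ / 2 * Gfun dpt j / (j : ℝ)| ≤ 2 * (|γ| / 2) := by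
          gcongr
          · linarith
          · exact abs_vorticity_term_le dpt γ hj
      _ = |γ| := by ring
  have h_lin : |m1 κ * (j : ℝ)| ≤ δ * J := by
    rw [abs_mul]
    gcongr
    exact Real.self_le_rpow_of_one_le h_one (by norm_num)
  have h_half : |m12 κ * |(j : ℝ)| ^ ((1 : ℝ) / 2)| ≤ δ * J := by
    rw [abs_mul, abs_of_nonneg (by positivity : 0 ≤ |(j : ℝ)| ^ ((1 : ℝ) / 2))]
    gcongr
    exact Real.rpow_le_rpow_of_exponent_le h_one (by norm_num)
  have := (abs_le.mp h_vort).1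
  have := (abs_le.mp h_lin).1
  have := (abs_le.mp h_half).1
  have := (abs_le.mp hr).1
  unfold muF OmegaF
  linarith

lemma abs_sum_intCast_mul_le {ν : ℕ} (ℓ : Fin ν → ℤ) (w B : Fin ν → ℝ) (hw : ∀ a, |w a| ≤ B a) :
    |∑ a, (ℓ a : ℝ) * w a| ≤ (∑ a, B a) * max 1 ‖ℓ‖ := by
  rw [Finset.sum_mul]
  refine (Finset.abs_sum_le_sum_abs _ _).trans (Finset.sum_le_sum fun a _ => ?_)
  rw [abs_mul, mul_comm]
  refine mul_le_mul (hw a) ?_ (abs_nonneg _) ((abs_nonneg _).trans (hw a))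
  rw [← Int.norm_eq_abs]
  exact (norm_le_pi_norm ℓ a).trans (le_max_right _ _)

/-- Nonempty first-Melnikov resonant sets force |j|^(3/2) ≲ ⟨ℓ⟩. -/
theorem resonant_set_I_nonempty_restriction
    (dpt g γ κ₁ κ₂ : ℝ) (hdpt : 0 < dpt) (hg : 0 < g) (hκ₁ : 0 < κ₁) (hκ₁₂ : κ₁ < κ₂)
    (ν : ℕ) (hν : 1 ≤ ν) (jbar : Fin ν → ℤ)
    (hjne : ∀ a, jbar a ≠ 0)
    (hjinj : Function.Injective fun a => |jbar a|)
    (C₀ τ : ℝ) (hC₀ : 0 < C₀) (hτ : 1 ≤ τ) :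
    ∃ ε₀ ∈ Set.Ioo (0 : ℝ) 1, ∃ C > (0 : ℝ),
      ∀ ε υ : ℝ, 0 < ε → ε ≤ υ → υ ≤ ε₀ →
      ∀ (m32 m1 m12 : ℝ → ℝ) (r : ℤ → ℝ → ℝ) (ωε : ℝ → Fin ν → ℝ),
        (∀ κ ∈ Set.Icc κ₁ κ₂,
          |m32 κ - 1| ≤ C₀ * ε ∧ |m1 κ| ≤ C₀ * ε ∧ |m12 κ| ≤ C₀ * ε ∧
          (∀ j : ℤ, j ≠ 0 → (∀ a, j ≠ jbar a) → |r j κ| ≤ C₀ * ε / υ) ∧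
          ‖(fun a => ωε κ a - OmegaF dpt g γ (jbar a) κ)‖ ≤ C₀ * ε / υ) →
      ∀ (ℓ : Fin ν → ℤ) (j : ℤ), j ≠ 0 → (∀ a, j ≠ jbar a) →
        (∑ a, jbar a * ℓ a) + j = 0 →
        (∃ κ ∈ Set.Icc κ₁ κ₂,
          |(∑ a, (ℓ a : ℝ) * ωε κ a) + muF dpt g γ m32 m1 m12 r j κ| <
            4 * υ * |(j : ℝ)| ^ ((3 : ℝ) / 2) * (max 1 ‖ℓ‖) ^ (-τ)) →
        |(j : ℝ)| ^ ((3 : ℝ) / 2) ≤ C * max 1 ‖ℓ‖ := by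
  set c := √(κ₁ * Real.tanh dpt)
  have hc : 0 < c := Real.sqrt_pos.mpr (mul_pos hκ₁ (tanh_pos_of_pos hdpt))
  set B : Fin ν → ℝ := fun a => omegaF dpt g γ (jbar a) κ₂ + |γ| / 2 + C₀ with hB
  have hB0 : 0 ≤ ∑ a, B a := Finset.sum_nonneg fun a _ => by
    have : 0 ≤ omegaF dpt g γ (jbar a) κ₂ := Real.sqrt_nonneg _
    positivity
  set ε₀ := min (1 / 2) (min (1 / (2 * C₀)) (c / (4 * (2 * C₀ + 4))))
  refine ⟨ε₀, ⟨by positivity, (min_le_left _ _).trans_lt (by norm_num)⟩,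
    4 / c * (|γ| + C₀ + ∑ a, B a), by positivity, ?_⟩
  rintro ε υ hε hευ hυ m32 m1 m12 r ωε hbounds ℓ j hj hjS - ⟨κ, hκ, hres⟩
  have hυ0 : 0 < υ := hε.trans_le hευ
  obtain ⟨hm32, hm1, hm12, hr, hω⟩ := hbounds κ hκ
  have h_ratio : C₀ * ε / υ ≤ C₀ := by
    rw [div_le_iff₀ hυ0]
    gcongr
  have hδ : C₀ * ε ≤ 1 / 2 := by
    have : ε ≤ 1 / (2 * C₀) :=
      (hευ.trans hυ).trans ((min_le_right _ _).trans (min_le_left _ _))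
    rw [le_div_iff₀ (by positivity)] at this
    linarith
  have h_small : 2 * (C₀ * ε) + 4 * υ ≤ c / 4 := by
    have h : υ ≤ c / (4 * (2 * C₀ + 4)) :=
      hυ.trans ((min_le_right _ _).trans (min_le_right _ _))
    rw [le_div_iff₀ (by positivity)] at h
    nlinarith
  have h_sum : |∑ a, (ℓ a : ℝ) * ωε κ a| ≤ (∑ a, B a) * max 1 ‖ℓ‖ := by
    refine abs_sum_intCast_mul_le ℓ _ B fun a => ?_
    have h₁ : |ωε κ a - OmegaF dpt g γ (jbar a) κ| ≤ C₀ :=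
      ((norm_le_pi_norm (fun a => ωε κ a - OmegaF dpt g γ (jbar a) κ) a).trans hω).trans h_ratio
    have h₂ := abs_OmegaF_le (g := g) (γ := γ) hdpt (hjne a) hκ.2
    have h₃ := abs_add_le (ωε κ a - OmegaF dpt g γ (jbar a) κ) (OmegaF dpt g γ (jbar a) κ)
    rw [sub_add_cancel] at h₃
    simp only [hB]
    linarith
  have h_mu := muF_lower_bound (g := g) (γ := γ) hdpt hg hκ₁ hκ.1 hδ hj hm32 hm1 hm12
    ((hr j hj hjS).trans h_ratio)
  set J := |(j : ℝ)| ^ ((3 : ℝ) / 2)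
  have hJ0 : 0 ≤ J := by positivity
  set L := max 1 ‖ℓ‖
  have hL : 1 ≤ L := le_max_left _ _
  have h_decay : 4 * υ * J * L ^ (-τ) ≤ 4 * υ * J :=
    mul_le_of_le_one_right (by positivity) (Real.rpow_le_one_of_one_le_of_nonpos hL (by linarith))
  have h_upper := (abs_lt.mp hres).2
  have h_neg := (abs_le.mp h_sum).1
  have h_absorb : (2 * (C₀ * ε) + 4 * υ) * J ≤ c / 4 * J := by gcongr
  have h_const : |γ| + C₀ ≤ (|γ| + C₀) * L := le_mul_of_one_le_right (by positivity) hL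
  have h_final : c / 4 * J ≤ (|γ| + C₀ + ∑ a, B a) * L := by linarith
  calc J = 4 / c * (c / 4 * J) := by field_simp
    _ ≤ 4 / c * ((|γ| + C₀ + ∑ a, B a) * L) := by gcongr
    _ = 4 / c * (|γ| + C₀ + ∑ a, B a) * L := by ring
end

section
/- (Measure estimate of a second-Melnikov resonant set.) Assume the unperturbed transversality bound: for all κ ∈ [κ₁, κ₂], all ℓ ∈ ℤ^ν and all j, j' ∈ S₀ᶜ with (ℓ, j, j') ≠ (0, j, j) and j⃗·ℓ + j − j' = 0, max over 0 ≤ n ≤ m₀ of |∂_κ^n(Ω⃗(κ)·ℓ + Ω_j(κ) − Ω_{j'}(κ))| ≥ ρ₀·⟨ℓ⟩. Set k₀ := m₀ + 2. Then there exist δ > 0 and C > 0, depending only on 𝚑, g, γ, κ₁, κ₂, the tangential sites, C₀, τ, m₀ and ρ₀, such that if ε·υ^{−(1+k₀)} ≤ δ, then for all ℓ ∈ ℤ^ν and all j, j' ∈ S₀ᶜ with (ℓ, j, j') ≠ (0, j, j) and j⃗·ℓ + j − j' = 0, the Lebesgue measure of the resonant set R^{(II)}_{ℓ,j,j'} :=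 {κ ∈ [κ₁, κ₂] : |ω⃗_ε(κ)·ℓ + μ_j(κ) − μ_{j'}(κ)| < 4υ·⟨|j|^{3/2} − |j'|^{3/2}⟩·⟨ℓ⟩^{−τ}} satisfies |R^{(II)}_{ℓ,j,j'}| ≤ C·(υ·⟨|j|^{3/2} − |j'|^{3/2}⟩·⟨ℓ⟩^{−(τ+1)})^{1/m₀}. -/
open Real Finset Set

lemma exists_separated_points {s : ℝ} (hs : 0 < s) (N : ℕ) : ∀ E : Set ℝ, BddBelow E →
    ENNReal.ofReal (2 * N * s) < MeasureTheory.volume E →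
    ∃ x : ℕ → ℝ, (∀ i < N, x i ∈ E) ∧ ∀ i, i + 1 < N → x i + s ≤ x (i + 1) := by
  induction N with
  | zero => exact fun E _ _ => ⟨fun _ => 0, by simp, by simp⟩
  | succ N ih =>
    intro E hE hvol
    have hne : E.Nonempty := by
      rw [Set.nonempty_iff_ne_empty]
      rintro rfl
      simp at hvol
    obtain ⟨x₀, hx₀, hlt⟩ := exists_lt_of_csInf_lt hne (lt_add_of_pos_right (sInf E) hs)
    have hrest : ENNReal.ofReal (2 * N * s) <
        MeasureTheory.volume (E ∩ Set.Ici (x₀ + s)) := by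
      by_contra! hle
      refine hvol.not_ge ?_
      have hsub : E ⊆ (E ∩ Set.Ici (x₀ + s)) ∪ Set.Icc (sInf E) (sInf E + 2 * s) := by
        intro y hy
        rcases le_or_gt (x₀ + s) y with h | h
        · exact Or.inl ⟨hy, h⟩
        · exact Or.inr ⟨csInf_le hE hy, by linarith⟩
      calc MeasureTheory.volume E
          ≤ MeasureTheory.volume (E ∩ Set.Ici (x₀ + s)) +
            MeasureTheory.volume (Set.Icc (sInf E) (sInf E + 2 * s)) :=
              (MeasureTheory.measure_mono hsub).trans (MeasureTheory.measure_union_le _ _)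
        _ ≤ ENNReal.ofReal (2 * N * s) + ENNReal.ofReal (2 * s) := by
              gcongr
              rw [Real.volume_Icc, add_sub_cancel_left]
        _ = ENNReal.ofReal (2 * (N + 1 : ℕ) * s) := by
              rw [← ENNReal.ofReal_add (by positivity) (by positivity)]
              congr 1
              push_cast
              ring
    obtain ⟨y, hyE, hysep⟩ := ih _ (hE.mono Set.inter_subset_left) hrest
    refine ⟨fun i => Nat.casesOn i x₀ y, ?_, ?_⟩
    · rintro (_ | i) hi
      · exact hx₀
      · exact (hyE i (by omega)).1
    · rintro (_ | i) hi
      · exact (hyE 0 (by omega)).2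
      · exact hysep i (by omega)

lemma exists_abs_lt_of_separated_points {J : Set ℝ} (hJ : J.OrdConnected) {s : ℝ} (hs : 0 < s)
    (n : ℕ) : ∀ (F : ℕ → ℝ → ℝ) (η : ℝ),
    (∀ k < n, ∀ x ∈ J, HasDerivAt (F k) (F (k + 1) x) x) →
    ∀ x : ℕ → ℝ, (∀ i < 2 ^ n, x i ∈ J ∧ |F 0 (x i)| < η) →
    (∀ i, i + 1 < 2 ^ n → x i + s ≤ x (i + 1)) →
    ∃ z ∈ J, |F n z| < η * (2 / s) ^ n := by
  induction n with
  | zero =>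
    intro F η _ x hx _
    exact ⟨x 0, (hx 0 (by simp)).1, by simpa using (hx 0 (by simp)).2⟩
  | succ n ih =>
    intro F η hF x hx hsep
    have hy : ∀ i, ∃ y, i < 2 ^ n →
        (x (2 * i) < y ∧ y < x (2 * i + 1)) ∧ y ∈ J ∧ |F 1 y| < η * (2 / s) := by
      intro i
      by_cases hi : i < 2 ^ n
      swap
      · exact ⟨0, fun h => absurd h hi⟩
      have hi1 : 2 * i + 1 < 2 ^ (n + 1) := by rw [pow_succ]; omega
      have hgap := hsep (2 * i) hi1
      have h0 := hx (2 * i) (by omega)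
      have h1 := hx (2 * i + 1) hi1
      have hsub := hJ.out h0.1 h1.1
      obtain ⟨y, hy, hslope⟩ := exists_hasDerivAt_eq_slope (F 0) (F 1)
        (by linarith : x (2 * i) < x (2 * i + 1))
        (fun z hz => (hF 0 (by omega) z (hsub hz)).continuousAt.continuousWithinAt)
        (fun z hz => hF 0 (by omega) z (hsub (Set.Ioo_subset_Icc_self hz)))
      refine ⟨y, fun _ => ⟨hy, hsub (Set.Ioo_subset_Icc_self hy), ?_⟩⟩
      have hpos : 0 < x (2 * i + 1) - x (2 * i) := by linarith
      have hη : 0 < η := (abs_nonneg _).trans_lt h0.2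
      rw [hslope, abs_div, abs_of_pos hpos, div_lt_iff₀ hpos]
      have hnum : |F 0 (x (2 * i + 1)) - F 0 (x (2 * i))| < 2 * η := by
        have := abs_sub (F 0 (x (2 * i + 1))) (F 0 (x (2 * i)))
        linarith [h0.2, h1.2]
      calc |F 0 (x (2 * i + 1)) - F 0 (x (2 * i))| < 2 * η := hnum
        _ = η * (2 / s) * s := by field_simp
        _ ≤ η * (2 / s) * (x (2 * i + 1) - x (2 * i)) := by gcongr; linarith
    choose y hy using hy
    obtain ⟨z, hz, hlt⟩ := ih (fun k => F (k + 1)) (η * (2 / s))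
      (fun k hk => hF (k + 1) (by omega)) y (fun i hi => (hy i hi).2) (by
        intro i hi
        have h0 := (hy i (by omega)).1.2
        have h1 := (hy (i + 1) hi).1.1
        have h2 := hsep (2 * i + 1) (by rw [pow_succ]; omega)
        rw [mul_add, mul_one] at h1
        rw [add_assoc] at h2
        linarith)
    exact ⟨z, hz, by rwa [pow_succ', ← mul_assoc]⟩

/-- Sublevel set estimate for a function with one large derivative on an interval. -/
lemma volume_sublevel_le {a b : ℝ} {n : ℕ} (hn : 1 ≤ n) {F : ℕ → ℝ → ℝ}
    (hF : ∀ k < n, ∀ x ∈ Set.Icc a b, HasDerivAt (F k) (F (k + 1) x) x)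
    {ρ η : ℝ} (hρ : 0 < ρ) (hη : 0 < η) (hlow : ∀ x ∈ Set.Icc a b, ρ ≤ |F n x|) :
    MeasureTheory.volume {x ∈ Set.Icc a b | |F 0 x| < η} ≤
      ENNReal.ofReal (4 * 2 ^ n * (η / ρ) ^ (1 / (n : ℝ))) := by
  by_contra! hlt
  set t := (η / ρ) ^ (1 / (n : ℝ)) with ht
  have ht0 : 0 < t := by positivity
  have htn : t ^ n = η / ρ := by
    rw [ht, one_div]
    exact Real.rpow_inv_natCast_pow (by positivity) (by omega)
  obtain ⟨x, hxE, hxs⟩ := exists_separated_points (by positivity : 0 < 2 * t) (2 ^ n)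
    {x ∈ Set.Icc a b | |F 0 x| < η} ⟨a, fun x hx => hx.1.1⟩
    (by convert hlt using 2; push_cast; ring)
  obtain ⟨z, hz, hzlt⟩ := exists_abs_lt_of_separated_points Set.ordConnected_Icc
    (by positivity : 0 < 2 * t) n F η hF x hxE hxs
  have : η * (2 / (2 * t)) ^ n = ρ := by
    rw [show 2 / (2 * t) = t⁻¹ by field_simp, inv_pow, htn]
    field_simp
  linarith [hlow z hz]

/-- A quantitative sublevel set estimate under a non-degeneracy condition of finite order. -/
lemma exists_volume_sublevel_le {a b : ℝ} (hab : a < b) {m : ℕ} (hm : 1 ≤ m) {M ρ : ℝ}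
    (hM : 0 < M) (hρ : 0 < ρ) :
    ∃ C > (0 : ℝ), ∀ (F : ℕ → ℝ → ℝ) (η : ℝ), 0 < η →
      (∀ k ≤ m, ∀ x ∈ Set.Icc a b, HasDerivAt (F k) (F (k + 1) x) x) →
      (∀ k ≤ m + 1, ∀ x ∈ Set.Icc a b, |F k x| ≤ M) →
      (∀ x ∈ Set.Icc a b, ∃ n ≤ m, ρ ≤ |F n x|) →
      MeasureTheory.volume {x ∈ Set.Icc a b | |F 0 x| < η} ≤
        ENNReal.ofReal (C * η ^ (1 / (m : ℝ))) := by
  obtain ⟨N, hN⟩ := exists_nat_gt ((b - a) * (2 * M / ρ))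
  have hba : 0 < b - a := sub_pos.2 hab
  have hN0 : (0 : ℝ) < N := lt_of_le_of_lt (by positivity) hN
  set h := (b - a) / N with hh
  have hh0 : 0 < h := by positivity
  have hMh : M * h ≤ ρ / 2 := by
    rw [hh, ← mul_div_assoc, div_le_iff₀ hN0]
    have : (b - a) * (2 * M / ρ) * ρ = (b - a) * (2 * M) := by field_simp
    nlinarith
  refine ⟨((b - a) + N * (4 * 2 ^ m)) * (ρ / 2)⁻¹ ^ (1 / (m : ℝ)), by positivity, ?_⟩
  intro F η hη hF hFM hlow
  have hfac : ((b - a) + N * (4 * 2 ^ m)) * (ρ / 2)⁻¹ ^ (1 / (m : ℝ)) * η ^ (1 / (m : ℝ)) =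
      ((b - a) + N * (4 * 2 ^ m)) * (η / (ρ / 2)) ^ (1 / (m : ℝ)) := by
    rw [mul_assoc, ← Real.mul_rpow (by positivity) hη.le, div_eq_inv_mul η]
  rw [hfac]
  set t := (η / (ρ / 2)) ^ (1 / (m : ℝ)) with ht
  have ht0 : 0 < t := by positivity
  rcases le_or_gt (ρ / 2) η with hbig | hsmall
  · have ht1 : 1 ≤ t := Real.one_le_rpow ((one_le_div (by positivity)).2 hbig) (by positivity)
    calc MeasureTheory.volume {x ∈ Set.Icc a b | |F 0 x| < η}
        ≤ MeasureTheory.volume (Set.Icc a b) := MeasureTheory.measure_mono (Set.sep_subset _ _)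
      _ = ENNReal.ofReal (b - a) := Real.volume_Icc
      _ ≤ _ := by
        apply ENNReal.ofReal_le_ofReal
        have : 0 ≤ (N : ℝ) * (4 * 2 ^ m) := by positivity
        nlinarith
  have hcell : ∀ i < N, MeasureTheory.volume
      {x ∈ Set.Icc (a + i * h) (a + (i + 1) * h) | |F 0 x| < η} ≤
      ENNReal.ofReal (4 * 2 ^ m * t) := by
    intro i hi
    have hi' : (i : ℝ) + 1 ≤ N := by exact_mod_cast hi
    have hNh : N * h = b - a := by rw [hh]; field_simp
    have hJ : Set.Icc (a + i * h) (a + (i + 1) * h) ⊆ Set.Icc a b := by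
      apply Set.Icc_subset_Icc
      · have : 0 ≤ i * h := by positivity
        linarith
      · have : (i + 1) * h ≤ N * h := by gcongr
        linarith
    have hleft : a + i * h ∈ Set.Icc (a + i * h) (a + (i + 1) * h) :=
      ⟨le_rfl, by linarith⟩
    obtain ⟨n, hn, hnρ⟩ := hlow _ (hJ hleft)
    have hnlow : ∀ x ∈ Set.Icc (a + i * h) (a + (i + 1) * h), ρ / 2 ≤ |F n x| := by
      intro x hx
      have hmv := (convex_Icc (a + i * h) (a + (i + 1) * h)).norm_image_sub_le_of_norm_hasDerivWithin_le
        (f := F n) (f' := F (n + 1)) (C := M)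
        (fun y hy => (hF n hn y (hJ hy)).hasDerivWithinAt)
        (fun y hy => hFM (n + 1) (by omega) y (hJ hy)) hx hleft
      rw [Real.norm_eq_abs, Real.norm_eq_abs] at hmv
      have h1 : |a + i * h - x| ≤ h := by
        rw [abs_le]
        constructor <;> linarith [hx.1, hx.2]
      have h2 : M * |a + i * h - x| ≤ M * h := by gcongr
      have h3 := abs_sub_abs_le_abs_sub (F n (a + i * h)) (F n x)
      linarith
    rcases Nat.eq_zero_or_pos n with rfl | hn0
    · rw [show {x ∈ Set.Icc (a + i * h) (a + (i + 1) * h) | |F 0 x| < η} = ∅ by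
        ext x
        simp only [Set.mem_ofPred_eq, Set.mem_empty_iff_false, iff_false, not_and, not_lt]
        exact fun hx => hsmall.le.trans (hnlow x hx)]
      simp
    · refine (volume_sublevel_le hn0 (fun k hk x hx => hF k (by omega) x (hJ hx))
        (by positivity) hη hnlow).trans (ENNReal.ofReal_le_ofReal ?_)
      have hexp : (η / (ρ / 2)) ^ (1 / (n : ℝ)) ≤ t := by
        apply Real.rpow_le_rpow_of_exponent_ge (by positivity)
          ((div_le_one (by positivity)).2 hsmall.le)
        have : (0 : ℝ) < n := by exact_mod_cast hn0
        gcongr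
      gcongr
      exact one_le_two
  have hcover : {x ∈ Set.Icc a b | |F 0 x| < η} ⊆ ⋃ i ∈ Finset.range N,
      {x ∈ Set.Icc (a + i * h) (a + (i + 1) * h) | |F 0 x| < η} := by
    rintro x ⟨hx, hxη⟩
    have hNh : N * h = b - a := by rw [hh]; field_simp
    have hN1 : 1 ≤ N := by exact_mod_cast hN0
    simp only [Set.mem_iUnion, Finset.mem_range]
    rcases eq_or_lt_of_le hx.2 with rfl | hxb
    · refine ⟨N - 1, by omega, ⟨?_, ?_⟩, hxη⟩
      · push_cast [hN1]
        linarith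
      · push_cast [hN1]
        linarith
    · have hq0 : 0 ≤ (x - a) / h := div_nonneg (by linarith [hx.1]) hh0.le
      refine ⟨⌊(x - a) / h⌋₊, ?_, ⟨?_, ?_⟩, hxη⟩
      · rw [Nat.floor_lt hq0, div_lt_iff₀ hh0]
        linarith
      · have := Nat.floor_le hq0
        rw [le_div_iff₀ hh0] at this
        linarith
      · have := (Nat.lt_floor_add_one ((x - a) / h)).le
        rw [div_le_iff₀ hh0] at this
        linarith
  calc MeasureTheory.volume {x ∈ Set.Icc a b | |F 0 x| < η}
      ≤ ∑ i ∈ Finset.range N, MeasureTheory.volume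
          {x ∈ Set.Icc (a + i * h) (a + (i + 1) * h) | |F 0 x| < η} :=
        (MeasureTheory.measure_mono hcover).trans (MeasureTheory.measure_biUnion_finset_le _ _)
    _ ≤ ∑ _i ∈ Finset.range N, ENNReal.ofReal (4 * 2 ^ m * t) :=
        Finset.sum_le_sum fun i hi => hcell i (Finset.mem_range.1 hi)
    _ = ENNReal.ofReal (N * (4 * 2 ^ m * t)) := by
        rw [Finset.sum_const, Finset.card_range, nsmul_eq_mul,
          ENNReal.ofReal_mul hN0.le, ENNReal.ofReal_natCast]
    _ ≤ _ := by
        apply ENNReal.ofReal_le_ofReal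
        nlinarith

lemma sq_mul_one_sub_tanh_le {x : ℝ} (hx : 0 ≤ x) : x ^ 2 * (1 - Real.tanh x) ≤ 1 := by
  have h1 := Real.quadratic_le_exp_of_nonneg (x := 2 * x) (by linarith)
  have h2 : Real.exp (2 * x) = Real.exp x * Real.exp x := by rw [← Real.exp_add]; ring_nf
  have h3 : Real.exp x * Real.exp (-x) = 1 := by rw [← Real.exp_add]; simp
  have h4 := Real.exp_pos x
  have h5 := Real.exp_pos (-x)
  rw [Real.tanh_eq, one_sub_div (by positivity), ← mul_div_assoc, div_le_one (by positivity)]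
  have h6 : 2 * x ^ 2 * Real.exp (-x) ≤ Real.exp x * Real.exp x * Real.exp (-x) :=
    mul_le_mul_of_nonneg_right (by nlinarith) h5.le
  rw [mul_assoc (Real.exp x), h3] at h6
  linarith

lemma tanh_nonneg_of_nonneg {x : ℝ} (hx : 0 ≤ x) : 0 ≤ Real.tanh x := by
  rw [Real.tanh_eq_sinh_div_cosh]
  exact div_nonneg (Real.sinh_nonneg_iff.2 hx) (Real.cosh_pos x).le

/-- The frequency `Ω_j` is a translate of the square root, up to scaling and constants. -/
lemma OmegaF_eq {dpt : ℝ} (hdpt : 0 < dpt) (g γ : ℝ) {j : ℤ} (hj : j ≠ 0) (κ : ℝ) :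
    OmegaF dpt g γ j κ =
      (|(j : ℝ)| ^ ((3 : ℝ) / 2) * √(Real.tanh (dpt * |(j : ℝ)|))) *
        √(κ + (g / (j : ℝ) ^ 2 + γ ^ 2 * Real.tanh (dpt * |(j : ℝ)|) / (4 * |(j : ℝ)| ^ 3))) +
      γ / 2 * Gfun dpt j / (j : ℝ) := by
  have hx : 0 < |(j : ℝ)| := abs_pos.2 (by exact_mod_cast hj)
  have hj' : (j : ℝ) ≠ 0 := by exact_mod_cast hj
  rw [OmegaF, omegaF]
  congr 1
  have hsq : (j : ℝ) ^ 2 = |(j : ℝ)| ^ 2 := (sq_abs _).symm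
  have ha := tanh_nonneg_of_nonneg (mul_pos hdpt hx).le
  have hpow : |(j : ℝ)| ^ ((3 : ℝ) / 2) = √(|(j : ℝ)| ^ 3) := by
    rw [Real.sqrt_eq_rpow, ← Real.rpow_natCast, ← Real.rpow_mul hx.le]
    norm_num
  rw [hpow, ← Real.sqrt_mul (by positivity), ← Real.sqrt_mul (by positivity), div_pow, mul_pow,
    mul_pow, hsq, Gfun_eq_abs]
  congr 1
  field_simp
  ring

lemma contDiffAt_OmegaF {dpt g γ : ℝ} (hdpt : 0 < dpt) (hg : 0 < g) {j : ℤ} (hj : j ≠ 0)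
    {κ : ℝ} (hκ : 0 < κ) {n : WithTop ℕ∞} : ContDiffAt ℝ n (OmegaF dpt g γ j) κ := by
  have hx : 0 < |(j : ℝ)| := abs_pos.2 (by exact_mod_cast hj)
  have ha := tanh_nonneg_of_nonneg (mul_pos hdpt hx).le
  rw [funext (OmegaF_eq hdpt g γ hj)]
  refine (contDiffAt_const.mul ?_).add contDiffAt_const
  exact (contDiffAt_id.add contDiffAt_const).sqrt (by simp only [id]; positivity)

lemma hasDerivAt_iteratedDeriv_of_contDiffAt {f : ℝ → ℝ} {x : ℝ} {n : ℕ} {m : WithTop ℕ∞}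
    (hf : ContDiffAt ℝ m f x) (hn : n < m) :
    HasDerivAt (iteratedDeriv n f) (iteratedDeriv (n + 1) f x) x := by
  rw [iteratedDeriv_succ]
  apply DifferentiableAt.hasDerivAt
  rw [iteratedDeriv_eq_equiv_comp, LinearIsometryEquiv.comp_differentiableAt_iff]
  exact hf.differentiableAt_iteratedFDeriv hn

lemma exists_abs_iteratedDeriv_sqrt_le {a b : ℝ} (ha : 0 < a) (N : ℕ) :
    ∃ P > (0 : ℝ), ∀ n ≤ N, ∀ x ∈ Set.Icc a b, |iteratedDeriv n Real.sqrt x| ≤ P := by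
  have hn : ∀ n : ℕ, ∃ P : ℝ, ∀ x ∈ Set.Icc a b, |iteratedDeriv n Real.sqrt x| ≤ P := by
    intro n
    refine isCompact_Icc.exists_bound_of_continuousOn (f := iteratedDeriv n Real.sqrt) ?_
    intro x hx
    exact (hasDerivAt_iteratedDeriv_of_contDiffAt (Real.contDiffAt_sqrt (n := (n + 1 : ℕ))
      (ha.trans_le hx.1).ne') (by exact_mod_cast n.lt_succ_self)).continuousAt.continuousWithinAt
  choose P hP using hn
  refine ⟨1 + ∑ n ∈ Finset.range (N + 1), |P n|, by positivity, fun n hnN x hx => ?_⟩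
  have := Finset.single_le_sum (f := fun n => |P n|) (fun i _ => abs_nonneg _)
    (Finset.mem_range.2 (Nat.lt_succ_of_le hnN))
  linarith [hP n x hx, le_abs_self (P n)]


lemma exists_abs_iteratedDeriv_OmegaF_sub_le {dpt g : ℝ} (γ : ℝ) {κ₁ κ₂ : ℝ} (hdpt : 0 < dpt)
    (hg : 0 < g) (hκ₁ : 0 < κ₁) (N : ℕ) :
    ∃ Q > (0 : ℝ), ∀ n ≤ N, ∀ κ ∈ Set.Icc κ₁ κ₂, ∀ j : ℤ, j ≠ 0 →
      |iteratedDeriv n (OmegaF dpt g γ j) κ -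
        |(j : ℝ)| ^ ((3 : ℝ) / 2) * iteratedDeriv n Real.sqrt κ| ≤ Q := by
  set B := g + γ ^ 2 / 4 with hB
  have hB0 : 0 < B := by positivity
  obtain ⟨P, hP, hPb⟩ := exists_abs_iteratedDeriv_sqrt_le (b := κ₂ + B) hκ₁ (N + 1)
  refine ⟨P / dpt ^ 2 + P * B + |γ|, by positivity, fun n hn κ hκ j hj => ?_⟩
  have hj' : (j : ℝ) ≠ 0 := by exact_mod_cast hj
  have hx1 : 1 ≤ |(j : ℝ)| := by exact_mod_cast Int.one_le_abs hj
  have hOmega := funext (OmegaF_eq hdpt g γ hj)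
  set x := |(j : ℝ)| with hx
  have hx0 : 0 < x := by linarith
  set t := Real.tanh (dpt * x) with ht
  have ht0 : 0 ≤ t := tanh_nonneg_of_nonneg (by positivity)
  have ht1 : t < 1 := Real.tanh_lt_one _
  set c := γ / 2 * Gfun dpt j / (j : ℝ) with hc
  have hcγ : |c| ≤ |γ| := by
    have h1 : |Real.tanh (dpt * (j : ℝ))| < 1 := Real.abs_tanh_lt_one _
    have h2 : c = γ * (Real.tanh (dpt * (j : ℝ)) / 2) := by
      rw [hc, Gfun]
      field_simp
    rw [h2, abs_mul, abs_div, abs_two]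
    nlinarith [abs_nonneg γ]
  set b := g / (j : ℝ) ^ 2 + γ ^ 2 * t / (4 * x ^ 3) with hb
  have hb0 : 0 ≤ b := by positivity
  have hbB : x ^ 2 * b ≤ B := by
    have h1 : x ^ 2 * b = g + γ ^ 2 * (t / x) / 4 := by
      rw [hb, ← sq_abs (j : ℝ), ← hx]
      field_simp
    have h2 : t / x ≤ 1 := (div_le_one hx0).2 (by linarith)
    rw [h1, hB]
    nlinarith [sq_nonneg γ]
  have hbB' : b ≤ B := (le_mul_of_one_le_left hb0 (one_le_pow₀ hx1)).trans hbB
  set y := x ^ ((3 : ℝ) / 2) with hy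
  have hy0 : 0 < y := by positivity
  have hyx : y ≤ x ^ 2 := by
    rw [hy, ← Real.rpow_two]
    exact Real.rpow_le_rpow_of_exponent_le hx1 (by norm_num)
  have hκ0 : 0 < κ := hκ₁.trans_le hκ.1
  have hmem : κ ∈ Set.Icc κ₁ (κ₂ + B) := ⟨hκ.1, by linarith [hκ.2]⟩
  have hmemb : κ + b ∈ Set.Icc κ₁ (κ₂ + B) := ⟨by linarith [hκ.1], by linarith [hκ.2]⟩
  have hφ : ContDiffAt ℝ n (fun κ' : ℝ => √(κ' + b)) κ :=
    (contDiffAt_id.add contDiffAt_const).sqrt (by simp only [id]; positivity)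
  have hder : iteratedDeriv n (OmegaF dpt g γ j) κ =
      y * √t * iteratedDeriv n Real.sqrt (κ + b) + iteratedDeriv n (fun _ : ℝ => c) κ := by
    rw [hOmega, iteratedDeriv_fun_add (contDiffAt_const.mul hφ) contDiffAt_const,
      iteratedDeriv_const_mul _ hφ, iteratedDeriv_comp_add_const]
  have hconst : |iteratedDeriv n (fun _ : ℝ => c) κ| ≤ |γ| := by
    rw [iteratedDeriv_const]
    split_ifs
    · exact hcγ
    · simp
  have hlip : |iteratedDeriv n Real.sqrt (κ + b) - iteratedDeriv n Real.sqrt κ| ≤ P * b := by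
    have := (convex_Icc κ₁ (κ₂ + B)).norm_image_sub_le_of_norm_hasDerivWithin_le
      (f := iteratedDeriv n Real.sqrt) (f' := iteratedDeriv (n + 1) Real.sqrt) (C := P)
      (fun z hz => (hasDerivAt_iteratedDeriv_of_contDiffAt
        (Real.contDiffAt_sqrt (n := (n + 1 : ℕ)) (hκ₁.trans_le hz.1).ne')
        (by exact_mod_cast n.lt_succ_self)).hasDerivWithinAt)
      (fun z hz => hPb (n + 1) (by omega) z hz) hmem hmemb
    rwa [add_sub_cancel_left, Real.norm_eq_abs, Real.norm_eq_abs, abs_of_nonneg hb0] at this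
  have hst0 : 0 ≤ √t := Real.sqrt_nonneg t
  have hst1 : t ≤ √t := Real.le_sqrt_of_sq_le (by nlinarith)
  have hst2 : √t ≤ 1 := Real.sqrt_le_one.2 ht1.le
  have hdecay : y * (1 - √t) ≤ 1 / dpt ^ 2 := by
    have h1 := sq_mul_one_sub_tanh_le (mul_pos hdpt hx0).le
    rw [← ht] at h1
    rw [le_div_iff₀ (by positivity)]
    calc y * (1 - √t) * dpt ^ 2 ≤ x ^ 2 * (1 - t) * dpt ^ 2 := by gcongr
      _ = (dpt * x) ^ 2 * (1 - t) := by ring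
      _ ≤ 1 := h1
  rw [hder, show y * √t * iteratedDeriv n Real.sqrt (κ + b) + iteratedDeriv n (fun _ : ℝ => c) κ -
      y * iteratedDeriv n Real.sqrt κ =
      -(y * (1 - √t) * iteratedDeriv n Real.sqrt (κ + b)) +
        y * (iteratedDeriv n Real.sqrt (κ + b) - iteratedDeriv n Real.sqrt κ) +
        iteratedDeriv n (fun _ : ℝ => c) κ by ring]
  refine (abs_add_three _ _ _).trans (add_le_add (add_le_add ?_ ?_) hconst)
  · rw [abs_neg, abs_mul, abs_of_nonneg (mul_nonneg hy0.le (by linarith))]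
    calc y * (1 - √t) * |iteratedDeriv n Real.sqrt (κ + b)| ≤ 1 / dpt ^ 2 * P := by
          gcongr
          exact hPb n (by omega) _ hmemb
      _ = P / dpt ^ 2 := by ring
  · rw [abs_mul, abs_of_pos hy0]
    calc y * |iteratedDeriv n Real.sqrt (κ + b) - iteratedDeriv n Real.sqrt κ|
        ≤ x ^ 2 * (P * b) := by gcongr
      _ = P * (x ^ 2 * b) := by ring
      _ ≤ P * B := by gcongr

lemma abs_iteratedDeriv_mul_le {f h : ℝ → ℝ} {x A H : ℝ} {n : ℕ}
    (hf : ContDiffAt ℝ n f x) (hh : ContDiffAt ℝ n h x)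
    (hfA : ∀ i ≤ n, |iteratedDeriv i f x| ≤ A) (hhH : ∀ i ≤ n, |iteratedDeriv i h x| ≤ H) :
    |iteratedDeriv n (fun y => f y * h y) x| ≤ 2 ^ n * A * H := by
  have hA : 0 ≤ A := (abs_nonneg _).trans (hfA 0 (Nat.zero_le n))
  rw [iteratedDeriv_fun_mul hf hh]
  refine (Finset.abs_sum_le_sum_abs _ _).trans ?_
  calc ∑ i ∈ Finset.range (n + 1), |n.choose i * iteratedDeriv i f x * iteratedDeriv (n - i) h x|
      ≤ ∑ i ∈ Finset.range (n + 1), (n.choose i : ℝ) * A * H := by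
        refine Finset.sum_le_sum fun i hi => ?_
        rw [abs_mul, abs_mul, Nat.abs_cast]
        have h1 := hfA i (Nat.lt_succ_iff.1 (Finset.mem_range.1 hi))
        have h2 := hhH (n - i) (Nat.sub_le n i)
        gcongr
    _ = 2 ^ n * A * H := by
        rw [← Finset.sum_mul, ← Finset.sum_mul, ← Nat.cast_sum, Nat.sum_range_choose]
        push_cast
        rfl

lemma abs_iteratedDeriv_linear_combination_le {ι : Type*} (s : Finset ι) (c : ι → ℝ)
    {w : ι → ℝ → ℝ} {x : ℝ} {n : ℕ} (hw : ∀ a ∈ s, ContDiffAt ℝ n (w a) x) {B : ι → ℝ}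
    (hB : ∀ a ∈ s, |iteratedDeriv n (w a) x| ≤ B a) :
    |iteratedDeriv n (fun y => ∑ a ∈ s, c a * w a y) x| ≤ ∑ a ∈ s, |c a| * B a := by
  rw [iteratedDeriv_fun_sum fun a ha => contDiffAt_const.mul (hw a ha)]
  refine (Finset.abs_sum_le_sum_abs _ _).trans (Finset.sum_le_sum fun a ha => ?_)
  rw [iteratedDeriv_const_mul _ (hw a ha), abs_mul]
  exact mul_le_mul_of_nonneg_left (hB a ha) (abs_nonneg _)

lemma abs_sqrt_sub_sqrt_le {x y : ℝ} (hx : 1 ≤ x) (hy : 1 ≤ y) :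
    |x ^ ((1 : ℝ) / 2) - y ^ ((1 : ℝ) / 2)| ≤ |x - y| := by
  rw [← Real.sqrt_eq_rpow, ← Real.sqrt_eq_rpow]
  have h1 : 1 ≤ √x := Real.one_le_sqrt.2 hx
  have h2 : 1 ≤ √y := Real.one_le_sqrt.2 hy
  have h3 : x - y = (√x - √y) * (√x + √y) := by
    have := Real.mul_self_sqrt (by linarith : 0 ≤ x)
    have := Real.mul_self_sqrt (by linarith : 0 ≤ y)
    linarith
  rw [h3, abs_mul]
  exact le_mul_of_one_le_right (abs_nonneg _) ((by linarith : 1 ≤ √x + √y).trans (le_abs_self _))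

/-- Derivatives of the difference between perturbed and unperturbed small divisors. -/
lemma abs_iteratedDeriv_perturbation_le {ι : Type*} (s : Finset ι) (c : ι → ℝ)
    {w : ι → ℝ → ℝ} {p h p₁ p₂ r r' : ℝ → ℝ} {x A H d₁ d₂ : ℝ} {n : ℕ}
    (hp : ContDiffAt ℝ n p x) (hh : ContDiffAt ℝ n h x) (hp₁ : ContDiffAt ℝ n p₁ x)
    (hp₂ : ContDiffAt ℝ n p₂ x) (hr : ContDiffAt ℝ n r x) (hr' : ContDiffAt ℝ n r' x)
    (hw : ∀ a ∈ s, ContDiffAt ℝ n (w a) x)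
    (hpA : ∀ i ≤ n, |iteratedDeriv i p x| ≤ A) (hhH : ∀ i ≤ n, |iteratedDeriv i h x| ≤ H)
    (hp₁A : |iteratedDeriv n p₁ x| ≤ A) (hp₂A : |iteratedDeriv n p₂ x| ≤ A)
    (hrA : |iteratedDeriv n r x| ≤ A) (hrA' : |iteratedDeriv n r' x| ≤ A)
    (hwA : ∀ a ∈ s, |iteratedDeriv n (w a) x| ≤ A) :
    |iteratedDeriv n (fun y => (∑ a ∈ s, c a * w a y) + p y * h y + d₁ * p₁ y + d₂ * p₂ y +
      r y - r' y) x| ≤ A * ((∑ a ∈ s, |c a|) + 2 ^ n * H + |d₁| + |d₂| + 2) := by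
  have hs : ContDiffAt ℝ n (fun y => ∑ a ∈ s, c a * w a y) x :=
    ContDiffAt.sum fun a ha => contDiffAt_const.mul (hw a ha)
  have hph : ContDiffAt ℝ n (fun y => p y * h y) x := hp.mul hh
  have h1 : ContDiffAt ℝ n (fun y => d₁ * p₁ y) x := contDiffAt_const.mul hp₁
  have h2 : ContDiffAt ℝ n (fun y => d₂ * p₂ y) x := contDiffAt_const.mul hp₂
  have hA1 := hs.add hph
  have hA2 := hA1.add h1
  have hA3 := hA2.add h2
  have hA4 := hA3.add hr
  rw [iteratedDeriv_fun_sub hA4 hr', iteratedDeriv_fun_add hA3 hr, iteratedDeriv_fun_add hA2 h2,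
    iteratedDeriv_fun_add hA1 h1, iteratedDeriv_fun_add hs hph, iteratedDeriv_const_mul _ hp₁,
    iteratedDeriv_const_mul _ hp₂]
  have b1 := abs_iteratedDeriv_linear_combination_le s c hw hwA
  have b2 := abs_iteratedDeriv_mul_le hp hh hpA hhH
  have b3 : |d₁ * iteratedDeriv n p₁ x| ≤ |d₁| * A := by rw [abs_mul]; gcongr
  have b4 : |d₂ * iteratedDeriv n p₂ x| ≤ |d₂| * A := by rw [abs_mul]; gcongr
  rw [← Finset.sum_mul] at b1
  rw [abs_le] at *
  constructor <;> linarith [b1.1, b1.2, b2.1, b2.2, b3.1, b3.2, b4.1, b4.2, hrA.1, hrA.2,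
    hrA'.1, hrA'.2]

set_option maxHeartbeats 4000000 in
/-- Measure estimate of a second-Melnikov resonant set. -/
theorem resonant_set_II_measure_estimate
    (dpt g γ κ₁ κ₂ : ℝ) (hdpt : 0 < dpt) (hg : 0 < g) (hκ₁ : 0 < κ₁) (hκ₁₂ : κ₁ < κ₂)
    (ν : ℕ) (hν : 1 ≤ ν) (jbar : Fin ν → ℤ)
    (hjne : ∀ a, jbar a ≠ 0)
    (hjinj : Function.Injective fun a => |jbar a|)
    (m₀ : ℕ) (hm₀ : 1 ≤ m₀) (ρ₀ : ℝ) (hρ₀ : 0 < ρ₀) (C₀ : ℝ) (hC₀ : 0 < C₀)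
    (τ : ℝ) (hτ : 1 ≤ τ)
    (htrans : ∀ κ ∈ Set.Icc κ₁ κ₂, ∀ ℓ : Fin ν → ℤ, ∀ j j' : ℤ,
      j ≠ 0 → (∀ a, j ≠ jbar a) → j' ≠ 0 → (∀ a, j' ≠ jbar a) →
      ¬(ℓ = 0 ∧ j = j') → (∑ a, jbar a * ℓ a) + j - j' = 0 →
      ∃ n ≤ m₀, ρ₀ * max 1 ‖ℓ‖ ≤
        |iteratedDeriv n
          (fun κ' => (∑ a, (ℓ a : ℝ) * OmegaF dpt g γ (jbar a) κ')
            + OmegaF dpt g γ j κ' - OmegaF dpt g γ j' κ') κ|) :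
    ∃ δ > (0 : ℝ), ∃ C > (0 : ℝ), ∀ ε υ : ℝ, 0 < ε → ε < 1 → 0 < υ → υ < 1 →
      ∀ (m32 m1 m12 : ℝ → ℝ) (r : ℤ → ℝ → ℝ) (ωε : ℝ → Fin ν → ℝ),
      ContDiff ℝ (m₀ + 2) m32 → ContDiff ℝ (m₀ + 2) m1 → ContDiff ℝ (m₀ + 2) m12 →
      (∀ j : ℤ, j ≠ 0 → (∀ a, j ≠ jbar a) → ContDiff ℝ (m₀ + 2) (r j)) →
      (∀ a, ContDiff ℝ (m₀ + 2) fun κ => ωε κ a) →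
      (∀ k ≤ m₀ + 2, ∀ κ ∈ Set.Icc κ₁ κ₂,
        |iteratedDeriv k (fun κ' => m32 κ' - 1) κ| ≤ C₀ * ε / υ ^ k ∧
        |iteratedDeriv k m1 κ| ≤ C₀ * ε / υ ^ k ∧
        |iteratedDeriv k m12 κ| ≤ C₀ * ε / υ ^ k ∧
        (∀ j : ℤ, j ≠ 0 → (∀ a, j ≠ jbar a) →
          |iteratedDeriv k (r j) κ| ≤ C₀ * ε / υ ^ (1 + k)) ∧
        (∀ a, |iteratedDeriv k (fun κ' => ωε κ' a - OmegaF dpt g γ (jbar a) κ') κ| ≤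
          C₀ * ε / υ ^ (1 + k))) →
      ε / υ ^ (1 + (m₀ + 2)) ≤ δ →
      ∀ (ℓ : Fin ν → ℤ) (j j' : ℤ),
        j ≠ 0 → (∀ a, j ≠ jbar a) → j' ≠ 0 → (∀ a, j' ≠ jbar a) →
        ¬(ℓ = 0 ∧ j = j') → (∑ a, jbar a * ℓ a) + j - j' = 0 →
        MeasureTheory.volume {κ ∈ Set.Icc κ₁ κ₂ |
            |(∑ a, (ℓ a : ℝ) * ωε κ a) + muF dpt g γ m32 m1 m12 r j κ
                - muF dpt g γ m32 m1 m12 r j' κ| <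
              4 * υ * max 1 |(|(j : ℝ)| ^ ((3 : ℝ) / 2) - |(j' : ℝ)| ^ ((3 : ℝ) / 2))|
                * (max 1 ‖ℓ‖) ^ (-τ)} ≤
          ENNReal.ofReal (C * (υ * max 1 |(|(j : ℝ)| ^ ((3 : ℝ) / 2) - |(j' : ℝ)| ^ ((3 : ℝ) / 2))|
            * (max 1 ‖ℓ‖) ^ (-(τ + 1))) ^ (1 / (m₀ : ℝ))) := by
  obtain ⟨P, hP, hPb⟩ := exists_abs_iteratedDeriv_sqrt_le (b := κ₂) hκ₁ (m₀ + 2)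
  obtain ⟨Q, hQ, hQb⟩ := exists_abs_iteratedDeriv_OmegaF_sub_le (κ₂ := κ₂) γ hdpt hg hκ₁ (m₀ + 2)
  set T := ∑ a, (|(jbar a : ℝ)| ^ ((3 : ℝ) / 2) * P + Q) with hT
  set A := ∑ a, |(jbar a : ℝ)| with hA
  have hT0 : 0 ≤ T := by positivity
  have hA0 : 0 ≤ A := by positivity
  set s := √κ₁ with hs
  have hs0 : 0 < s := Real.sqrt_pos.2 hκ₁
  set E₁ := C₀ * (2 ^ (m₀ + 2) * (P + 2 * Q)) with hE₁
  set E₂ := C₀ * (ν + 2 * A + 2) with hE₂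
  have hE₁0 : 0 < E₁ := by positivity
  have hE₂0 : 0 < E₂ := by positivity
  set K := 1 + 4 * (2 * Q + T + E₂) / s with hK
  have hK1 : 1 ≤ K := by
    rw [hK]
    have : 0 ≤ 4 * (2 * Q + T + E₂) / s := by positivity
    linarith
  obtain ⟨Cs, hCs, hsub⟩ := exists_volume_sublevel_le hκ₁₂ hm₀
    (M := T + (P + 2 * Q) * K + E₁ * K + E₂) (ρ := ρ₀ / 2) (by positivity) (by positivity)
  refine ⟨min 1 (min (s / (4 * E₁)) (ρ₀ / 2 / (E₁ * K + E₂))), by positivity,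
    Cs * 4 ^ (1 / (m₀ : ℝ)) + (κ₂ - κ₁) * (s / 8)⁻¹ ^ (1 / (m₀ : ℝ)),
    add_pos_of_pos_of_nonneg (by positivity)
      (mul_nonneg (sub_pos.2 hκ₁₂).le (by positivity)), ?_⟩
  intro ε υ hε hε1 hυ hυ1 m32 m1 m12 r ωε hm32 hm1 hm12 hr hωε hbd hδ ℓ j j' hj hjS hj' hjS' hne hmom
  set θ := ε / υ ^ (1 + (m₀ + 2)) with hθ
  have hθ0 : 0 < θ := by positivity
  have hθ1 : θ ≤ 1 := hδ.trans (min_le_left _ _)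
  have hθs : θ * E₁ ≤ s / 4 := by
    have := hδ.trans ((min_le_right _ _).trans (min_le_left _ _))
    rw [le_div_iff₀ (by positivity)] at this
    linarith
  have hθρ : θ * (E₁ * K + E₂) ≤ ρ₀ / 2 := by
    have := hδ.trans ((min_le_right _ _).trans (min_le_right _ _))
    rwa [le_div_iff₀ (by positivity)] at this
  have hpow : ∀ k ≤ 1 + (m₀ + 2), C₀ * ε / υ ^ k ≤ C₀ * θ := by
    intro k hk
    rw [hθ, mul_div_assoc]
    have := pow_le_pow_of_le_one hυ.le hυ1.le hk
    gcongr
  set L := max 1 ‖ℓ‖ with hL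
  have hL1 : 1 ≤ L := le_max_left _ _
  have hL0 : 0 < L := by linarith
  have hℓL : ∀ a, |(ℓ a : ℝ)| ≤ L := fun a => by
    rw [← Int.norm_eq_abs]
    exact (norm_le_pi_norm ℓ a).trans (le_max_right _ _)
  set D := |(j : ℝ)| ^ ((3 : ℝ) / 2) - |(j' : ℝ)| ^ ((3 : ℝ) / 2) with hD
  set Dl := max 1 |D| with hDl
  have hDl1 : 1 ≤ Dl := le_max_left _ _
  have hDDl : |D| ≤ Dl := le_max_right _ _
  set X := υ * Dl * L ^ (-(τ + 1)) with hX
  have hX0 : 0 < X := by positivity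
  have hXη : 4 * υ * Dl * L ^ (-τ) = 4 * X * L := by
    rw [hX, show -τ = -(τ + 1) + 1 by ring, Real.rpow_add_one hL0.ne']
    ring
  have hΩ : ∀ i : ℤ, i ≠ 0 → ∀ κ ∈ Set.Icc κ₁ κ₂, ∀ n : ℕ,
      ContDiffAt ℝ n (OmegaF dpt g γ i) κ := fun i hi κ hκ n =>
    contDiffAt_OmegaF hdpt hg hi (hκ₁.trans_le hκ.1)
  set W : ℝ → ℝ := fun κ => ∑ a, (ℓ a : ℝ) * OmegaF dpt g γ (jbar a) κ with hW
  set h : ℝ → ℝ := fun κ => OmegaF dpt g γ j κ - OmegaF dpt g γ j' κ with hh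
  have hWc : ∀ κ ∈ Set.Icc κ₁ κ₂, ∀ n : ℕ, ContDiffAt ℝ n W κ := fun κ hκ n =>
    ContDiffAt.sum fun a _ => contDiffAt_const.mul (hΩ _ (hjne a) κ hκ n)
  have hhc : ∀ κ ∈ Set.Icc κ₁ κ₂, ∀ n : ℕ, ContDiffAt ℝ n h κ := fun κ hκ n =>
    (hΩ j hj κ hκ n).sub (hΩ j' hj' κ hκ n)
  have hWb : ∀ n ≤ m₀ + 2, ∀ κ ∈ Set.Icc κ₁ κ₂, |iteratedDeriv n W κ| ≤ T * L := by
    intro n hn κ hκ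
    refine (abs_iteratedDeriv_linear_combination_le Finset.univ (fun a => (ℓ a : ℝ))
      (fun a _ => hΩ _ (hjne a) κ hκ n)
      (B := fun a => |(jbar a : ℝ)| ^ ((3 : ℝ) / 2) * P + Q) fun a _ => ?_).trans ?_
    · have h1 := hQb n hn κ hκ (jbar a) (hjne a)
      have h2 : |(|(jbar a : ℝ)| ^ ((3 : ℝ) / 2) * iteratedDeriv n Real.sqrt κ)| ≤
          |(jbar a : ℝ)| ^ ((3 : ℝ) / 2) * P := by
        rw [abs_mul, abs_of_nonneg (by positivity)]
        gcongr
        exact hPb n hn κ hκ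
      have h3 := abs_sub_abs_le_abs_sub (iteratedDeriv n (OmegaF dpt g γ (jbar a)) κ)
        (|(jbar a : ℝ)| ^ ((3 : ℝ) / 2) * iteratedDeriv n Real.sqrt κ)
      linarith
    · rw [hT, Finset.sum_mul]
      refine Finset.sum_le_sum fun a _ => ?_
      rw [mul_comm]
      gcongr
      exact hℓL a
  have hhD : ∀ n ≤ m₀ + 2, ∀ κ ∈ Set.Icc κ₁ κ₂,
      |iteratedDeriv n h κ - D * iteratedDeriv n Real.sqrt κ| ≤ 2 * Q := by
    intro n hn κ hκ
    have h1 := hQb n hn κ hκ j hj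
    have h2 := hQb n hn κ hκ j' hj'
    rw [hh, iteratedDeriv_fun_sub (hΩ j hj κ hκ n) (hΩ j' hj' κ hκ n), hD]
    rw [abs_le] at *
    constructor <;> linarith [h1.1, h1.2, h2.1, h2.2]
  have hhb : ∀ n ≤ m₀ + 2, ∀ κ ∈ Set.Icc κ₁ κ₂,
      |iteratedDeriv n h κ| ≤ (P + 2 * Q) * Dl := by
    intro n hn κ hκ
    have h1 := hhD n hn κ hκ
    have h2 : |D * iteratedDeriv n Real.sqrt κ| ≤ Dl * P := by
      rw [abs_mul]
      gcongr
      exact hPb n hn κ hκ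
    have h3 := abs_sub_abs_le_abs_sub (iteratedDeriv n h κ) (D * iteratedDeriv n Real.sqrt κ)
    nlinarith
  have hjj : |(j : ℝ) - j'| ≤ A * L := by
    have h1 : (j : ℝ) - j' = -∑ a, (jbar a : ℝ) * ℓ a := by
      have : ((∑ a, jbar a * ℓ a : ℤ) : ℝ) + j - j' = 0 := by exact_mod_cast hmom
      push_cast at this
      linarith
    rw [h1, abs_neg, hA, Finset.sum_mul]
    refine (Finset.abs_sum_le_sum_abs _ _).trans (Finset.sum_le_sum fun a _ => ?_)
    rw [abs_mul]
    gcongr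
    exact hℓL a
  have hjj2 : |(|(j : ℝ)| ^ ((1 : ℝ) / 2) - |(j' : ℝ)| ^ ((1 : ℝ) / 2))| ≤ A * L :=
    (abs_sqrt_sub_sqrt_le (by exact_mod_cast Int.one_le_abs hj)
      (by exact_mod_cast Int.one_le_abs hj')).trans ((abs_abs_sub_abs_le _ _).trans hjj)
  set f : ℝ → ℝ := fun κ => (∑ a, (ℓ a : ℝ) * ωε κ a) + muF dpt g γ m32 m1 m12 r j κ
    - muF dpt g γ m32 m1 m12 r j' κ with hf
  set f₀ : ℝ → ℝ := fun κ => W κ + h κ with hf₀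
  set p : ℝ → ℝ := fun κ => (∑ a, (ℓ a : ℝ) * (ωε κ a - OmegaF dpt g γ (jbar a) κ)) +
    (m32 κ - 1) * h κ + ((j : ℝ) - j') * m1 κ +
    (|(j : ℝ)| ^ ((1 : ℝ) / 2) - |(j' : ℝ)| ^ ((1 : ℝ) / 2)) * m12 κ + r j κ - r j' κ with hp
  have hfp : f = fun κ => f₀ κ + p κ := by
    funext κ
    simp only [hf, hf₀, hp, hW, hh, muF, mul_sub, Finset.sum_sub_distrib]
    ring
  have hcast : ∀ n ≤ m₀ + 2, (n : WithTop ℕ∞) ≤ m₀ + 2 := fun n hn => by exact_mod_cast hn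
  have hwc : ∀ n ≤ m₀ + 2, ∀ κ ∈ Set.Icc κ₁ κ₂, ∀ a, ContDiffAt ℝ n
      (fun κ' => ωε κ' a - OmegaF dpt g γ (jbar a) κ') κ := fun n hn κ hκ a =>
    ((hωε a).contDiffAt.of_le (hcast n hn)).sub (hΩ _ (hjne a) κ hκ n)
  have hpc : ∀ n ≤ m₀ + 2, ∀ κ ∈ Set.Icc κ₁ κ₂, ContDiffAt ℝ n p κ := by
    intro n hn κ hκ
    have hn' := hcast n hn
    exact (((((ContDiffAt.sum fun a _ => contDiffAt_const.mul (hwc n hn κ hκ a)).add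
      (((hm32.contDiffAt.of_le hn').sub contDiffAt_const).mul (hhc κ hκ n))).add
      (contDiffAt_const.mul (hm1.contDiffAt.of_le hn'))).add
      (contDiffAt_const.mul (hm12.contDiffAt.of_le hn'))).add
      ((hr j hj hjS).contDiffAt.of_le hn')).sub ((hr j' hj' hjS').contDiffAt.of_le hn')
  have hpb : ∀ n ≤ m₀ + 2, ∀ κ ∈ Set.Icc κ₁ κ₂,
      |iteratedDeriv n p κ| ≤ θ * (E₁ * Dl + E₂ * L) := by
    intro n hn κ hκ
    have hn' := hcast n hn
    refine (abs_iteratedDeriv_perturbation_le Finset.univ (fun a => (ℓ a : ℝ))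
      (w := fun a κ' => ωε κ' a - OmegaF dpt g γ (jbar a) κ') (p := fun κ' => m32 κ' - 1)
      (A := C₀ * θ) (H := (P + 2 * Q) * Dl)
      ((hm32.contDiffAt.of_le hn').sub contDiffAt_const) (hhc κ hκ n)
      (hm1.contDiffAt.of_le hn') (hm12.contDiffAt.of_le hn')
      ((hr j hj hjS).contDiffAt.of_le hn') ((hr j' hj' hjS').contDiffAt.of_le hn')
      (fun a _ => hwc n hn κ hκ a)
      (fun i hi => (hbd i (hi.trans hn) κ hκ).1.trans (hpow i (by omega)))
      (fun i hi => hhb i (hi.trans hn) κ hκ)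
      ((hbd n hn κ hκ).2.1.trans (hpow n (by omega)))
      ((hbd n hn κ hκ).2.2.1.trans (hpow n (by omega)))
      (((hbd n hn κ hκ).2.2.2.1 j hj hjS).trans (hpow (1 + n) (by omega)))
      (((hbd n hn κ hκ).2.2.2.1 j' hj' hjS').trans (hpow (1 + n) (by omega)))
      (fun a _ => ((hbd n hn κ hκ).2.2.2.2 a).trans (hpow (1 + n) (by omega)))).trans ?_
    have hsum : ∑ a, |(ℓ a : ℝ)| ≤ ν * L := by
      refine (Finset.sum_le_sum fun a _ => hℓL a).trans ?_
      simp
    have h2n : (2 : ℝ) ^ n ≤ 2 ^ (m₀ + 2) := pow_le_pow_right₀ one_le_two hn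
    calc _ ≤ C₀ * θ * (ν * L + 2 ^ (m₀ + 2) * ((P + 2 * Q) * Dl) + A * L + A * L + 2 * L) := by
          gcongr
          linarith
      _ = θ * (E₁ * Dl + E₂ * L) := by
          rw [hE₁, hE₂]
          ring
  have hf₀c : ∀ κ ∈ Set.Icc κ₁ κ₂, ∀ n : ℕ, ContDiffAt ℝ n f₀ κ := fun κ hκ n =>
    (hWc κ hκ n).add (hhc κ hκ n)
  have hsplit : ∀ n ≤ m₀ + 2, ∀ κ ∈ Set.Icc κ₁ κ₂,
      iteratedDeriv n f κ = iteratedDeriv n f₀ κ + iteratedDeriv n p κ := by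
    intro n hn κ hκ
    rw [hfp, iteratedDeriv_fun_add (hf₀c κ hκ n) (hpc n hn κ hκ)]
  rw [hXη]
  have hCX : (Cs * 4 ^ (1 / (m₀ : ℝ)) + (κ₂ - κ₁) * (s / 8)⁻¹ ^ (1 / (m₀ : ℝ))) *
      X ^ (1 / (m₀ : ℝ)) = Cs * (4 * X) ^ (1 / (m₀ : ℝ)) +
        (κ₂ - κ₁) * ((s / 8)⁻¹ * X) ^ (1 / (m₀ : ℝ)) := by
    rw [Real.mul_rpow (by positivity) hX0.le, Real.mul_rpow (by positivity) hX0.le]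
    ring
  have hκκ : 0 < κ₂ - κ₁ := sub_pos.2 hκ₁₂
  rw [hCX]
  rcases le_or_gt Dl (K * L) with hDK | hDK
  · have hDθ : θ * (E₁ * Dl + E₂ * L) ≤ θ * (E₁ * K + E₂) * L := by
      have : E₁ * Dl ≤ E₁ * (K * L) := by gcongr
      nlinarith
    have hset : {κ ∈ Set.Icc κ₁ κ₂ | |f κ| < 4 * X * L} =
        {κ ∈ Set.Icc κ₁ κ₂ | |(fun n κ' => iteratedDeriv n f κ' / L) 0 κ| < 4 * X} := by
      ext κ
      simp only [Set.mem_ofPred_eq, iteratedDeriv_zero, abs_div, abs_of_pos hL0,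
        div_lt_iff₀ hL0]
    rw [hset]
    refine (hsub (fun n κ' => iteratedDeriv n f κ' / L) (4 * X) (by positivity) ?_ ?_ ?_).trans
      (ENNReal.ofReal_le_ofReal (le_add_of_nonneg_right (by positivity)))
    · intro k hk κ hκ
      have hfc : ContDiffAt ℝ (m₀ + 2 : ℕ) f κ := by
        rw [hfp]
        exact (hf₀c κ hκ _).add (hpc _ le_rfl κ hκ)
      exact (hasDerivAt_iteratedDeriv_of_contDiffAt hfc
        (by exact_mod_cast (by omega : k < m₀ + 2))).div_const L
    · intro k hk κ hκ
      have hk' : k ≤ m₀ + 2 := by omega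
      rw [abs_div, abs_of_pos hL0, div_le_iff₀ hL0, hsplit k hk' κ hκ, hf₀,
        iteratedDeriv_fun_add (hWc κ hκ k) (hhc κ hκ k)]
      refine (abs_add_three _ _ _).trans ?_
      have h1 := hWb k hk' κ hκ
      have h2 := hhb k hk' κ hκ
      have h3 := hpb k hk' κ hκ
      have h4 : (P + 2 * Q) * Dl ≤ (P + 2 * Q) * (K * L) := by gcongr
      have h5 : θ * (E₁ * K + E₂) * L ≤ 1 * (E₁ * K + E₂) * L := by gcongr
      linarith
    · intro κ hκ
      obtain ⟨n, hn, hlow⟩ := htrans κ hκ ℓ j j' hj hjS hj' hjS' hne hmom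
      refine ⟨n, hn, ?_⟩
      have hn' : n ≤ m₀ + 2 := by omega
      have hf₀eq : (fun κ' => (∑ a, (ℓ a : ℝ) * OmegaF dpt g γ (jbar a) κ')
          + OmegaF dpt g γ j κ' - OmegaF dpt g γ j' κ') = f₀ := by
        funext κ'
        simp only [hf₀, hW, hh]
        ring
      rw [hf₀eq] at hlow
      rw [abs_div, abs_of_pos hL0, le_div_iff₀ hL0, hsplit n hn' κ hκ]
      have h1 := hpb n hn' κ hκ
      have h2 : θ * (E₁ * K + E₂) * L ≤ ρ₀ / 2 * L := by gcongr
      have h3 := abs_sub_abs_le_abs_add (iteratedDeriv n f₀ κ) (iteratedDeriv n p κ)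
      linarith
  · rcases Set.eq_empty_or_nonempty {κ ∈ Set.Icc κ₁ κ₂ | |f κ| < 4 * X * L} with hemp | hnonemp
    · rw [hemp]
      simp
    obtain ⟨κ, hκ, hlt⟩ := hnonemp
    have hDeq : Dl = |D| := by
      refine max_eq_right (le_of_not_gt fun hlt1 => ?_)
      have : Dl = 1 := max_eq_left hlt1.le
      nlinarith
    have h0 : 0 ≤ m₀ + 2 := Nat.zero_le _
    have h1 := hWb 0 h0 κ hκ
    have h2 := hhD 0 h0 κ hκ
    have h3 := hpb 0 h0 κ hκ
    have h4 := hsplit 0 h0 κ hκ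
    simp only [iteratedDeriv_zero] at h1 h2 h3 h4
    have h5 : s * Dl ≤ |D * √κ| := by
      rw [abs_mul, abs_of_nonneg (Real.sqrt_nonneg κ), ← hDeq, mul_comm]
      gcongr
      exact Real.sqrt_le_sqrt hκ.1
    have hlow : s / 2 * Dl ≤ |f κ| := by
      have h6 : |D * √κ| ≤ |f κ| + |h κ - D * √κ| + |W κ| + |p κ| := by
        have h4' : f κ = W κ + h κ + p κ := h4
        have e : D * √κ = f κ - (h κ - D * √κ) - W κ - p κ := by
          rw [h4']
          ring
        have e' := congrArg abs e
        have t1 := abs_sub (f κ - (h κ - D * √κ) - W κ) (p κ)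
        have t2 := abs_sub (f κ - (h κ - D * √κ)) (W κ)
        have t3 := abs_sub (f κ) (h κ - D * √κ)
        linarith
      have h7 : θ * (E₁ * Dl + E₂ * L) ≤ s / 4 * Dl + E₂ * L := by
        have h8 : θ * E₁ * Dl ≤ s / 4 * Dl := by gcongr
        have h9 : θ * (E₂ * L) ≤ 1 * (E₂ * L) := by gcongr
        linarith
      have h10 : (2 * Q + T + E₂) * L ≤ s / 4 * Dl := by
        have h11 : s * K = s + 4 * (2 * Q + T + E₂) := by
          rw [hK]
          field_simp
        have h12 : s * (K * L) ≤ s * Dl := by gcongr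
        have h13 : s * (K * L) = s * L + 4 * ((2 * Q + T + E₂) * L) := by
          rw [← mul_assoc, h11]
          ring
        have h14 : 0 < s * L := by positivity
        linarith
      have h15 : 2 * Q ≤ 2 * Q * L := le_mul_of_one_le_right (by positivity) hL1
      linarith
    have hXs : s / 8 ≤ X := by
      have h6 : s / 8 * Dl < X * L := by linarith
      have h7 : s / 8 * L ≤ s / 8 * Dl := by
        have : L ≤ K * L := le_mul_of_one_le_left hL0.le hK1
        gcongr
        linarith
      exact (lt_of_mul_lt_mul_right (h7.trans_lt h6) hL0.le).le
    have hone : 1 ≤ ((s / 8)⁻¹ * X) ^ (1 / (m₀ : ℝ)) := by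
      refine Real.one_le_rpow ?_ (by positivity)
      rw [inv_mul_eq_div, one_le_div (by positivity)]
      exact hXs
    calc MeasureTheory.volume {κ ∈ Set.Icc κ₁ κ₂ | |f κ| < 4 * X * L}
        ≤ MeasureTheory.volume (Set.Icc κ₁ κ₂) :=
          MeasureTheory.measure_mono (Set.sep_subset _ _)
      _ = ENNReal.ofReal (κ₂ - κ₁) := Real.volume_Icc
      _ ≤ _ := by
        apply ENNReal.ofReal_le_ofReal
        have : 0 ≤ Cs * (4 * X) ^ (1 / (m₀ : ℝ)) := by positivity
        nlinarith
end
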